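/- arXiv:1511.01790 — 3 statements merged into one kernel-verified Lean document; each statement's English description precedes it below -/
import Mathlib

section
/- Let l ≥ 3, Δ ≥ 3 and n ≥ l + Δ. Let G_b be the unicyclic graph on n vertices obtained from the cycle C_l by attaching one end-vertex of a path on n−l−Δ+1 vertices to a cycle vertex and attaching Δ−1 pendant vertices to the other end-vertex of that path (which then has degree Δ). Then Kf(G_b) = (l³−l)/12 + (n−l−Δ+2)(n−l−Δ+3)(n−l+2Δ−2)/6 + (n−l)(l²−1)/6 + (Δ−1)(Δ−2) + (n−l−Δ+2)(Δ−1)(l−1) + (l−1)(n−l−Δ+1)(n−l−Δ+2)/2. -/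
open scoped Classical

noncomputable section

namespace KfPaper

variable {V : Type*} {W : Type*}

/-- The energy of a potential `f` on graph `G`, viewing each edge as a unit resistor:
`(1/2) · ∑_{x,y adjacent} (f x - f y)²` (each edge counted twice, hence the `1/2`). -/
def energy [Fintype V] (G : SimpleGraph V) (f : V → ℝ) : ℝ :=
  (1 / 2) * ∑ x : V, ∑ y : V, (if G.Adj x y then (f x - f y) ^ 2 else 0)

/-- The resistance distance (effective resistance) between `u` and `v`:
`r(u,v) = 1 / inf { energy f : f u = 1, f v = 0 }` and `r(u,u) = 0`. -/
def resistanceDistance [Fintype V] (G : SimpleGraph V) (u v : V) : ℝ :=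
  if u = v then 0
  else 1 / sInf {e : ℝ | ∃ f : V → ℝ, f u = 1 ∧ f v = 0 ∧ energy G f = e}

/-- The Kirchhoff index: sum of resistance distances over unordered pairs of distinct
vertices (each ordered pair counted once via the factor `1/2`, diagonal terms vanish). -/
def kirchhoffIndex [Fintype V] (G : SimpleGraph V) : ℝ :=
  (1 / 2) * ∑ u : V, ∑ v : V, resistanceDistance G u v

/-- `Kf_v(G) = ∑_{u ≠ v} r(v,u)` (the term `u = v` contributes `0`). -/
def kirchhoffAt [Fintype V] (G : SimpleGraph V) (v : V) : ℝ :=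
  ∑ u : V, resistanceDistance G v u

/-- The Wiener index: sum of graph distances over unordered pairs of distinct vertices. -/
def wienerIndex [Fintype V] (G : SimpleGraph V) : ℝ :=
  (1 / 2) * ∑ u : V, ∑ v : V, (G.dist u v : ℝ)

/-- `W_v(G) = ∑_u d(v,u)`. -/
def wienerAt [Fintype V] (G : SimpleGraph V) (v : V) : ℝ :=
  ∑ u : V, (G.dist v u : ℝ)

/-- The degree of a vertex. -/
def degree' (G : SimpleGraph V) (v : V) : ℕ := Nat.card (G.neighborSet v)

/-- `G` has maximum degree `Δ`. -/
def HasMaxDegree (G : SimpleGraph V) (Δ : ℕ) : Prop :=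
  (∀ v, degree' G v ≤ Δ) ∧ ∃ v, degree' G v = Δ

/-- A unicyclic graph: a connected graph containing exactly one cycle, equivalently a
connected graph with as many edges as vertices. -/
def IsUnicyclic [Fintype V] (G : SimpleGraph V) : Prop :=
  G.Connected ∧ Nat.card G.edgeSet = Fintype.card V

/-- `G_b`: the unicyclic graph on `Fin n` with the cycle `0,…,l−1`, one end-vertex of the
path `l,…,n−Δ` (on `n−l−Δ+1` vertices) attached to the cycle vertex `0`, and `Δ−1`
pendant vertices `n−Δ+1,…,n−1` attached to the other end-vertex `n−Δ` of the path
(so `n−Δ` has degree `Δ`). -/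
def Gb (n l Δ : ℕ) : SimpleGraph (Fin n) :=
  SimpleGraph.fromRel (fun i j =>
    (i.val + 1 = j.val ∧ j.val ≤ l - 1) ∨
    (i.val = 0 ∧ j.val = l - 1) ∨
    (i.val = 0 ∧ j.val = l) ∨
    (l ≤ i.val ∧ i.val + 1 = j.val ∧ j.val ≤ n - Δ) ∨
    (i.val = n - Δ ∧ n - Δ < j.val))

/-- The bilinear form polarizing `energy`. -/
def energyForm [Fintype V] (G : SimpleGraph V) (f g : V → ℝ) : ℝ :=
  (1 / 2) * ∑ x : V, ∑ y : V, (if G.Adj x y then (f x - f y) * (g x - g y) else 0)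

lemma energy_nonneg [Fintype V] (G : SimpleGraph V) (f : V → ℝ) : 0 ≤ energy G f := by
  unfold energy
  refine mul_nonneg (by norm_num) (Finset.sum_nonneg fun x _ => Finset.sum_nonneg fun y _ => ?_)
  split_ifs
  · positivity
  · exact le_rfl

lemma energy_sub_smul [Fintype V] (G : SimpleGraph V) (f h : V → ℝ) (t : ℝ) :
    energy G (fun x => h x - t * f x)
      = energy G h - 2 * t * energyForm G f h + t ^ 2 * energyForm G f f := by
  unfold energy energyForm
  simp only [Finset.mul_sum, ← Finset.sum_add_distrib, ← Finset.sum_sub_distrib]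
  refine Finset.sum_congr rfl fun x _ => Finset.sum_congr rfl fun y _ => ?_
  split_ifs <;> ring

lemma energy_sub_mul_const [Fintype V] (G : SimpleGraph V) (f : V → ℝ) (a t : ℝ) :
    energy G (fun x => (f x - a) * t) = t ^ 2 * energyForm G f f := by
  unfold energy energyForm
  simp only [Finset.mul_sum]
  refine Finset.sum_congr rfl fun x _ => Finset.sum_congr rfl fun y _ => ?_
  split_ifs <;> ring

/-- If `f` is the potential of a unit current flowing from `u` to `v`, the resistance distance
is the potential difference. -/
theorem resistanceDistance_eq_of_potential [Fintype V] (G : SimpleGraph V) (u v : V) (f : V → ℝ)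
    (hf : ∀ g : V → ℝ, energyForm G f g = g u - g v) :
    resistanceDistance G u v = f u - f v := by
  unfold resistanceDistance
  split_ifs with huv
  · simp [huv]
  have key : ∀ h : V → ℝ, h u = 1 → h v = 0 → ∀ t : ℝ,
      0 ≤ energy G h - 2 * t + t ^ 2 * (f u - f v) := by
    intro h hu hv t
    have := energy_nonneg G (fun x => h x - t * f x)
    rw [energy_sub_smul, hf, hf, hu, hv] at this
    linarith
  have hR : 0 < f u - f v := by
    have hu : Function.update (0 : V → ℝ) u 1 u = 1 := by simp
    have hv : Function.update (0 : V → ℝ) u 1 v = 0 := by simp [Ne.symm huv]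
    have h0 := energy_nonneg G (Function.update (0 : V → ℝ) u 1)
    by_contra! hneg
    have h1 := key _ hu hv (energy G (Function.update (0 : V → ℝ) u 1) + 1)
    nlinarith [mul_nonneg (sq_nonneg (energy G (Function.update (0 : V → ℝ) u 1) + 1))
      (sub_nonneg.2 hneg)]
  set R := f u - f v with hRdef
  have hleast : IsLeast {e : ℝ | ∃ h : V → ℝ, h u = 1 ∧ h v = 0 ∧ energy G h = e} (1 / R) := by
    constructor
    · refine ⟨fun x => (f x - f v) * (1 / R), ?_, by simp, ?_⟩
      · change R * (1 / R) = 1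
        field_simp
      · rw [energy_sub_mul_const, hf, ← hRdef]; field_simp
    · rintro e ⟨h, hu, hv, rfl⟩
      have h1 := key h hu hv (1 / R)
      have h2 : (1 / R) ^ 2 * R = 1 / R := by field_simp
      rw [h2] at h1
      linarith
  rw [hleast.csInf_eq, one_div_one_div]

/-- Parent of a vertex in the spanning tree of `Gb` obtained by deleting the edge
`{0, l - 1}`, rooted at `0`; here `e = n - Δ`. -/
def parentIdx (l e k : ℕ) : ℕ := if k = l then 0 else if k ≤ e then k - 1 else e

/-- Indicator that the non-root vertex `i` lies on the tree path from `v` to the root. -/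
def ancestorInd (l e i v : ℕ) : ℝ :=
  if 1 ≤ i ∧ (i < l ∧ i ≤ v ∧ v < l ∨ l ≤ i ∧ i ≤ e ∧ i ≤ v ∨ e < i ∧ i = v) then 1 else 0

/-- Position on the cycle of the cycle vertex nearest to `v`. -/
def cyclePos (l v : ℕ) : ℝ := if v < l then (v : ℝ) else 0

lemma parentIdx_lt {l e k : ℕ} (hl : 3 ≤ l) (hk : 1 ≤ k) : parentIdx l e k < k := by
  unfold parentIdx; split_ifs <;> omega

lemma parentIdx_lt_of_lt {l e k n : ℕ} (hl : 3 ≤ l) (hk : k < n) : parentIdx l e k < n := by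
  unfold parentIdx; split_ifs <;> omega

lemma ancestorInd_sub_parentIdx {l e : ℕ} (hl : 3 ≤ l) (he : l ≤ e) (i : ℕ) {j : ℕ}
    (hj : 1 ≤ j) :
    ancestorInd l e i j - ancestorInd l e i (parentIdx l e j) = if i = j then 1 else 0 := by
  unfold ancestorInd parentIdx
  split_ifs <;> first | omega | norm_num

lemma cyclePos_sub_parentIdx {l e : ℕ} (hl : 3 ≤ l) (he : l ≤ e) {j : ℕ} (hj : 1 ≤ j) :
    cyclePos l j - cyclePos l (parentIdx l e j) = if j < l then 1 else 0 := by
  unfold cyclePos parentIdx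
  split_ifs <;> first | omega | skip
  all_goals try simp
  all_goals first | omega | (push_cast [Nat.cast_sub hj]; ring)

lemma ancestorInd_root (l e i : ℕ) :
    ancestorInd l e i 0 = 0 := by
  unfold ancestorInd
  rw [if_neg]; omega

/-- Summing the increments of `g` along the tree path from the root to `u`. -/
lemma sum_ancestorInd_mul_sub {l e n : ℕ} (hl : 3 ≤ l) (he : l ≤ e) (g : ℕ → ℝ) (u : ℕ)
    (hu : u < n) :
    ∑ j ∈ Finset.range n, ancestorInd l e j u * (g j - g (parentIdx l e j)) = g u - g 0 := by
  induction u using Nat.strong_induction_on with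
  | _ u ih =>
    rcases Nat.eq_zero_or_pos u with rfl | hpos
    · simp [ancestorInd_root]
    · have hlt := parentIdx_lt (e := e) hl hpos
      have h1 := ih _ hlt (hlt.trans hu)
      have h2 : ∀ j ∈ Finset.range n, ancestorInd l e j u * (g j - g (parentIdx l e j))
          = ancestorInd l e j (parentIdx l e u) * (g j - g (parentIdx l e j))
            + if j = u then g j - g (parentIdx l e j) else 0 := by
        intro j _
        have := ancestorInd_sub_parentIdx hl he j hpos
        rw [sub_eq_iff_eq_add'.1 this]
        split_ifs <;> ring
      rw [Finset.sum_congr rfl h2, Finset.sum_add_distrib, h1, Finset.sum_ite_eq',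
        if_pos (Finset.mem_range.2 hu)]
      ring

lemma Gb_adj_iff {n l Δ : ℕ} (hl : 3 ≤ l) (hn : l + Δ ≤ n) (x y : Fin n) :
    (Gb n l Δ).Adj x y ↔ x.val ≠ y.val ∧ (y.val = parentIdx l (n - Δ) x.val
      ∨ x.val = parentIdx l (n - Δ) y.val ∨ (x.val = 0 ∧ y.val = l - 1)
      ∨ (x.val = l - 1 ∧ y.val = 0)) := by
  have := x.2
  have := y.2
  unfold Gb parentIdx
  rw [SimpleGraph.fromRel_adj, Ne, Fin.ext_iff]
  split_ifs <;> omega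

/-- A sum over the adjacent pairs of `Gb` is a sum over tree edges plus the closing edge. -/
lemma sum_Gb_adj {n l Δ : ℕ} (hl : 3 ≤ l) (hn : l + Δ ≤ n) (F : ℕ → ℕ → ℝ)
    (hF : ∀ x, F x x = 0) (hsymm : ∀ x y, F x y = F y x) :
    ∑ x : Fin n, ∑ y : Fin n, (if (Gb n l Δ).Adj x y then F x y else 0)
      = 2 * (∑ j ∈ Finset.range n, F j (parentIdx l (n - Δ) j) + F 0 (l - 1)) := by
  have h1 : ∀ x y : Fin n, (if (Gb n l Δ).Adj x y then F x y else 0)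
      = (if y.val = parentIdx l (n - Δ) x.val then F x y else 0)
        + (if x.val = parentIdx l (n - Δ) y.val then F x y else 0)
        + (if y.val = l - 1 then if x.val = 0 then F x y else 0 else 0)
        + (if y.val = 0 then if x.val = l - 1 then F x y else 0 else 0) := by
    intro x y
    simp only [Gb_adj_iff hl hn]
    by_cases hxy : x.val = y.val
    · simp [hxy, hF]
    · have hx : x.val = 0 ∨ 1 ≤ x.val := by omega
      have hy : y.val = 0 ∨ 1 ≤ y.val := by omega
      unfold parentIdx
      split_ifs <;> first | omega | simp
  simp only [h1]
  simp only [Fin.sum_univ_eq_sum_range (fun x => ∑ y : Fin n,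
    ((if y.val = parentIdx l (n - Δ) x then F x y else 0)
        + (if x = parentIdx l (n - Δ) y.val then F x y else 0)
        + (if y.val = l - 1 then if x = 0 then F x y else 0 else 0)
        + (if y.val = 0 then if x = l - 1 then F x y else 0 else 0))) n]
  simp only [fun x => Fin.sum_univ_eq_sum_range (fun y =>
    ((if y = parentIdx l (n - Δ) x then F x y else 0)
        + (if x = parentIdx l (n - Δ) y then F x y else 0)
        + (if y = l - 1 then if x = 0 then F x y else 0 else 0)
        + (if y = 0 then if x = l - 1 then F x y else 0 else 0))) n]
  simp only [Finset.sum_add_distrib]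
  have e1 : ∑ x ∈ Finset.range n, ∑ y ∈ Finset.range n,
      (if y = parentIdx l (n - Δ) x then F x y else 0)
      = ∑ j ∈ Finset.range n, F j (parentIdx l (n - Δ) j) := by
    refine Finset.sum_congr rfl fun x hx => ?_
    rw [Finset.sum_ite_eq', if_pos]
    exact Finset.mem_range.2 (parentIdx_lt_of_lt hl (Finset.mem_range.1 hx))
  have e2 : ∑ x ∈ Finset.range n, ∑ y ∈ Finset.range n,
      (if x = parentIdx l (n - Δ) y then F x y else 0)
      = ∑ j ∈ Finset.range n, F j (parentIdx l (n - Δ) j) := by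
    rw [Finset.sum_comm, ← e1]
    refine Finset.sum_congr rfl fun x _ => Finset.sum_congr rfl fun y _ => ?_
    rw [hsymm]
  have e3 : ∀ a b : ℕ, a < n → b < n → ∑ x ∈ Finset.range n, ∑ y ∈ Finset.range n,
      (if y = b then if x = a then F x y else 0 else 0) = F a b := by
    intro a b ha hb
    simp only [Finset.sum_ite_eq', Finset.mem_range, ha, hb, if_true]
  rw [e1, e2, e3 0 (l - 1) (by omega) (by omega), e3 (l - 1) 0 (by omega) (by omega),
    hsymm (l - 1) 0]
  ring

lemma sum_ancestorInd_cycle {l e : ℕ} (he : l ≤ e) (u : ℕ) :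
    ∑ j ∈ Finset.range l, ancestorInd l e j u = cyclePos l u := by
  have h : ∀ j ∈ Finset.range l, ancestorInd l e j u
      = if j ∈ Finset.Icc 1 u then (if u < l then 1 else 0) else 0 := by
    intro j hj
    rw [Finset.mem_range] at hj
    unfold ancestorInd
    simp only [Finset.mem_Icc]
    split_ifs <;> first | omega | rfl
  rw [Finset.sum_congr rfl h, ← Finset.sum_filter]
  unfold cyclePos
  split_ifs with hu
  · have : (Finset.range l).filter (fun j => j ∈ Finset.Icc 1 u) = Finset.Icc 1 u := by
      ext j; simp only [Finset.mem_filter, Finset.mem_range, Finset.mem_Icc]; omega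
    rw [this]; simp
  · simp

/-- Potential on `Gb` of a unit current from `u` to `v`. -/
def currentPotential (n l e u v x : ℕ) : ℝ :=
  ∑ i ∈ Finset.range n, ancestorInd l e i x * (ancestorInd l e i u - ancestorInd l e i v)
    - cyclePos l x * (cyclePos l u - cyclePos l v) / l

lemma currentPotential_sub_parentIdx {n l e : ℕ} (hl : 3 ≤ l) (he : l ≤ e) (u v : ℕ) {j : ℕ}
    (hj : 1 ≤ j) (hjn : j < n) :
    currentPotential n l e u v j - currentPotential n l e u v (parentIdx l e j)
      = ancestorInd l e j u - ancestorInd l e j v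
        - if j < l then (cyclePos l u - cyclePos l v) / l else 0 := by
  have h1 : ∑ i ∈ Finset.range n,
        ancestorInd l e i j * (ancestorInd l e i u - ancestorInd l e i v)
      - ∑ i ∈ Finset.range n,
        ancestorInd l e i (parentIdx l e j) * (ancestorInd l e i u - ancestorInd l e i v)
      = ancestorInd l e j u - ancestorInd l e j v := by
    rw [← Finset.sum_sub_distrib]
    simp only [← sub_mul, ancestorInd_sub_parentIdx hl he _ hj, ite_mul, one_mul, zero_mul]
    rw [Finset.sum_ite_eq', if_pos (Finset.mem_range.2 hjn)]
  have h2 := cyclePos_sub_parentIdx hl he hj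
  unfold currentPotential
  calc _ = ancestorInd l e j u - ancestorInd l e j v
        - (cyclePos l j - cyclePos l (parentIdx l e j))
          * ((cyclePos l u - cyclePos l v) / l) := by rw [← h1]; ring
    _ = _ := by rw [h2]; split_ifs <;> ring

lemma currentPotential_closing_edge {n l e : ℕ} (hl : 3 ≤ l) (he : l ≤ e) (hn : l ≤ n)
    (u v : ℕ) :
    currentPotential n l e u v 0 - currentPotential n l e u v (l - 1)
      = - ((cyclePos l u - cyclePos l v) / l) := by
  have h0 : currentPotential n l e u v 0 = 0 := by
    simp [currentPotential, ancestorInd_root, cyclePos]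
  have h1 : ∑ i ∈ Finset.range n,
      ancestorInd l e i (l - 1) * (ancestorInd l e i u - ancestorInd l e i v)
      = cyclePos l u - cyclePos l v := by
    rw [← sum_ancestorInd_cycle he u, ← sum_ancestorInd_cycle he v, ← Finset.sum_sub_distrib]
    symm
    apply Finset.sum_subset_zero_on_sdiff (Finset.range_subset_range.2 hn)
    · intro i hi
      simp only [Finset.mem_sdiff, Finset.mem_range] at hi
      have : ancestorInd l e i (l - 1) = 0 := by
        unfold ancestorInd; rw [if_neg]; omega
      rw [this, zero_mul]
    · intro i hi
      rw [Finset.mem_range] at hi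
      rcases Nat.eq_zero_or_pos i with rfl | hpos
      · simp [ancestorInd]
      · have : ancestorInd l e i (l - 1) = 1 := by
          unfold ancestorInd; rw [if_pos]; omega
        rw [this, one_mul]
  have h2 : cyclePos l (l - 1) = (l : ℝ) - 1 := by
    unfold cyclePos
    rw [if_pos (by omega), Nat.cast_sub (by omega), Nat.cast_one]
  have hl0 : (l : ℝ) ≠ 0 := by positivity
  rw [h0]
  unfold currentPotential
  rw [h1, h2]
  field_simp
  ring

lemma sum_cycle_increments {n l e : ℕ} (hl : 3 ≤ l) (he : l ≤ e) (hn : l ≤ n) (g : ℕ → ℝ) :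
    ∑ j ∈ Finset.range n, (if j < l then g j - g (parentIdx l e j) else 0) = g (l - 1) - g 0 := by
  rw [← sum_ancestorInd_mul_sub hl he g (l - 1) (n := n) (by omega)]
  refine Finset.sum_congr rfl fun j _ => ?_
  rcases Nat.eq_zero_or_pos j with rfl | hpos
  · simp [parentIdx]
  · unfold ancestorInd
    split_ifs <;> first | omega | simp

theorem resistanceDistance_Gb {n l Δ : ℕ} (hl : 3 ≤ l) (hn : l + Δ ≤ n)
    (u v : Fin n) :
    resistanceDistance (Gb n l Δ) u v
      = ∑ j ∈ Finset.range n, (ancestorInd l (n - Δ) j u - ancestorInd l (n - Δ) j v) ^ 2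
        - (cyclePos l u - cyclePos l v) ^ 2 / l := by
  have he : l ≤ n - Δ := by omega
  set e := n - Δ with hedef
  rw [resistanceDistance_eq_of_potential (Gb n l Δ) u v
    (fun x => currentPotential n l e u v x)]
  · unfold currentPotential
    have : ∑ j ∈ Finset.range n, (ancestorInd l e j u - ancestorInd l e j v) ^ 2
        = ∑ i ∈ Finset.range n, ancestorInd l e i u * (ancestorInd l e i u - ancestorInd l e i v)
        - ∑ i ∈ Finset.range n,
          ancestorInd l e i v * (ancestorInd l e i u - ancestorInd l e i v) := by
      rw [← Finset.sum_sub_distrib]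
      exact Finset.sum_congr rfl fun _ _ => by ring
    rw [this]
    ring
  · intro g₀
    obtain ⟨g, hg⟩ : ∃ g : ℕ → ℝ, ∀ x : Fin n, g₀ x = g x :=
      ⟨fun k => if h : k < n then g₀ ⟨k, h⟩ else 0, fun x => by simp⟩
    unfold energyForm
    simp only [hg]
    rw [sum_Gb_adj hl hn (fun x y => (currentPotential n l e u v x
      - currentPotential n l e u v y) * (g x - g y)) (fun x => by ring) (fun x y => by ring),
      currentPotential_closing_edge hl he (by omega), ← hedef]
    set c := (cyclePos l u - cyclePos l v) / l
    have h : ∀ j ∈ Finset.range n, (currentPotential n l e u v j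
        - currentPotential n l e u v (parentIdx l e j)) * (g j - g (parentIdx l e j))
        = ancestorInd l e j u * (g j - g (parentIdx l e j))
          - ancestorInd l e j v * (g j - g (parentIdx l e j))
          - c * (if j < l then g j - g (parentIdx l e j) else 0) := by
      intro j hj
      rcases Nat.eq_zero_or_pos j with rfl | hpos
      · simp [parentIdx]
      · rw [currentPotential_sub_parentIdx hl he u v hpos (Finset.mem_range.1 hj)]
        split_ifs <;> ring
    rw [Finset.sum_congr rfl h, Finset.sum_sub_distrib, Finset.sum_sub_distrib,
      ← Finset.mul_sum, sum_ancestorInd_mul_sub hl he g u u.2,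
      sum_ancestorInd_mul_sub hl he g v v.2, sum_cycle_increments hl he (by omega)]
    ring

lemma sum_sum_sub_sq (n : ℕ) (a : ℕ → ℝ) :
    ∑ u ∈ Finset.range n, ∑ v ∈ Finset.range n, (a u - a v) ^ 2
      = 2 * (n * ∑ u ∈ Finset.range n, a u ^ 2 - (∑ u ∈ Finset.range n, a u) ^ 2) := by
  simp only [sub_sq, Finset.sum_add_distrib, Finset.sum_sub_distrib, Finset.sum_const,
    Finset.card_range, nsmul_eq_mul, mul_assoc, ← Finset.mul_sum, ← Finset.sum_mul]
  ring

/-- Number of descendants of the non-root vertex `i` in the spanning tree. -/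
def subtreeSize (n l e i : ℕ) : ℝ :=
  if i = 0 then 0 else if i < l then (l : ℝ) - i else if i ≤ e then (n : ℝ) - i else 1

lemma sum_ancestorInd {n l e i : ℕ} (he : l ≤ e) (hen : e < n) (hi : i < n) :
    ∑ u ∈ Finset.range n, ancestorInd l e i u = subtreeSize n l e i := by
  unfold ancestorInd subtreeSize
  rw [Finset.sum_boole]
  split_ifs with h0 h1 h2
  · simp [h0]
  · have : (Finset.range n).filter (fun v => 1 ≤ i ∧ (i < l ∧ i ≤ v ∧ v < l ∨
        l ≤ i ∧ i ≤ e ∧ i ≤ v ∨ e < i ∧ i = v)) = Finset.Ico i l := by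
      ext v; simp only [Finset.mem_filter, Finset.mem_range, Finset.mem_Ico]; omega
    rw [this, Nat.card_Ico, Nat.cast_sub h1.le]
  · have : (Finset.range n).filter (fun v => 1 ≤ i ∧ (i < l ∧ i ≤ v ∧ v < l ∨
        l ≤ i ∧ i ≤ e ∧ i ≤ v ∨ e < i ∧ i = v)) = Finset.Ico i n := by
      ext v; simp only [Finset.mem_filter, Finset.mem_range, Finset.mem_Ico]; omega
    rw [this, Nat.card_Ico, Nat.cast_sub hi.le]
  · have : (Finset.range n).filter (fun v => 1 ≤ i ∧ (i < l ∧ i ≤ v ∧ v < l ∨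
        l ≤ i ∧ i ≤ e ∧ i ≤ v ∨ e < i ∧ i = v)) = {i} := by
      ext v; simp only [Finset.mem_filter, Finset.mem_range, Finset.mem_singleton]; omega
    rw [this]; simp

lemma sum_range_cast (m : ℕ) : ∑ i ∈ Finset.range m, (i : ℝ) = m * (m - 1) / 2 := by
  induction m with
  | zero => simp
  | succ k ih => rw [Finset.sum_range_succ, ih]; push_cast; ring

lemma sum_range_cast_sq (m : ℕ) :
    ∑ i ∈ Finset.range m, (i : ℝ) ^ 2 = m * (m - 1) * (2 * m - 1) / 6 := by
  induction m with
  | zero => simp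
  | succ k ih => rw [Finset.sum_range_succ, ih]; push_cast; ring

lemma sum_cyclePos_pow {n l : ℕ} (hn : l ≤ n) {k : ℕ} (hk : k ≠ 0) :
    ∑ i ∈ Finset.range n, cyclePos l i ^ k = ∑ i ∈ Finset.range l, (i : ℝ) ^ k := by
  symm
  apply Finset.sum_subset_zero_on_sdiff (Finset.range_subset_range.2 hn)
  · intro i hi
    simp only [Finset.mem_sdiff, Finset.mem_range] at hi
    simp [cyclePos, hi.2, hk]
  · intro i hi
    simp [cyclePos, Finset.mem_range.1 hi]

theorem kirchhoffIndex_Gb_eq_sum {n l Δ : ℕ} (hl : 3 ≤ l) (hΔ : 3 ≤ Δ) (hn : l + Δ ≤ n) :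
    kirchhoffIndex (Gb n l Δ)
      = ∑ j ∈ Finset.range n,
          subtreeSize n l (n - Δ) j * (n - subtreeSize n l (n - Δ) j)
        - (n * ∑ i ∈ Finset.range l, (i : ℝ) ^ 2 - (∑ i ∈ Finset.range l, (i : ℝ)) ^ 2) / l := by
  unfold kirchhoffIndex
  simp only [resistanceDistance_Gb hl hn]
  simp only [fun u : Fin n => Fin.sum_univ_eq_sum_range (fun v =>
    ∑ j ∈ Finset.range n, (ancestorInd l (n - Δ) j u - ancestorInd l (n - Δ) j v) ^ 2
        - (cyclePos l u - cyclePos l v) ^ 2 / l) n]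
  rw [Fin.sum_univ_eq_sum_range (fun u => ∑ v ∈ Finset.range n,
    (∑ j ∈ Finset.range n, (ancestorInd l (n - Δ) j u - ancestorInd l (n - Δ) j v) ^ 2
        - (cyclePos l u - cyclePos l v) ^ 2 / l)) n]
  simp only [Finset.sum_sub_distrib, ← Finset.sum_div]
  have hc1 := sum_cyclePos_pow (n := n) (l := l) (by omega) one_ne_zero
  simp only [pow_one] at hc1
  rw [sum_sum_sub_sq, sum_cyclePos_pow (by omega) two_ne_zero, hc1]
  have h : ∑ u ∈ Finset.range n, ∑ v ∈ Finset.range n, ∑ j ∈ Finset.range n,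
      (ancestorInd l (n - Δ) j u - ancestorInd l (n - Δ) j v) ^ 2
      = 2 * ∑ j ∈ Finset.range n,
          subtreeSize n l (n - Δ) j * (n - subtreeSize n l (n - Δ) j) := by
    rw [Finset.sum_congr rfl fun u _ => Finset.sum_comm, Finset.sum_comm, Finset.mul_sum]
    refine Finset.sum_congr rfl fun j hj => ?_
    have hsq : ∀ u ∈ Finset.range n,
        ancestorInd l (n - Δ) j u ^ 2 = ancestorInd l (n - Δ) j u := by
      intro u _
      unfold ancestorInd
      split_ifs <;> norm_num
    rw [sum_sum_sub_sq, Finset.sum_congr rfl hsq,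
      sum_ancestorInd (by omega) (by omega) (Finset.mem_range.1 hj)]
    ring
  rw [h]
  ring

lemma sum_subtreeSize (l d m : ℕ) (hl : 3 ≤ l) :
    ∑ j ∈ Finset.range (l + (m + 1) + d), subtreeSize (l + (m + 1) + d) l (l + m) j
          * (((l + (m + 1) + d : ℕ) : ℝ) - subtreeSize (l + (m + 1) + d) l (l + m) j)
      = ∑ j ∈ Finset.range l, ((l : ℝ) - j) * (m + 1 + d + j) - l * (m + 1 + d)
        + ∑ k ∈ Finset.range (m + 1), ((m : ℝ) + 1 + d - k) * (l + k)
        + d * (l + m + d) := by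
  rw [Finset.sum_range_add, Finset.sum_range_add]
  congr 1
  · congr 1
    · obtain ⟨l, rfl⟩ : ∃ k, l = k + 1 := ⟨l - 1, by omega⟩
      rw [Finset.sum_range_succ', Finset.sum_range_succ']
      have : ∀ j ∈ Finset.range l,
          subtreeSize (l + 1 + (m + 1) + d) (l + 1) (l + 1 + m) (j + 1)
            * (((l + 1 + (m + 1) + d : ℕ) : ℝ)
              - subtreeSize (l + 1 + (m + 1) + d) (l + 1) (l + 1 + m) (j + 1))
          = (((l + 1 : ℕ) : ℝ) - ((j + 1 : ℕ) : ℝ)) * (m + 1 + d + ((j + 1 : ℕ) : ℝ)) := by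
        intro j hj
        rw [Finset.mem_range] at hj
        unfold subtreeSize
        rw [if_neg (by omega), if_pos (by omega)]
        push_cast; ring
      rw [Finset.sum_congr rfl this]
      simp [subtreeSize]
    · refine Finset.sum_congr rfl fun k hk => ?_
      rw [Finset.mem_range] at hk
      unfold subtreeSize
      rw [if_neg (by omega), if_neg (by omega), if_pos (by omega)]
      push_cast; ring
  · have : ∀ k ∈ Finset.range d, subtreeSize (l + (m + 1) + d) l (l + m) (l + (m + 1) + k)
        * (((l + (m + 1) + d : ℕ) : ℝ)
          - subtreeSize (l + (m + 1) + d) l (l + m) (l + (m + 1) + k)) = (l : ℝ) + m + d := by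
      intro k _
      unfold subtreeSize
      rw [if_neg (by omega), if_neg (by omega), if_neg (by omega)]
      push_cast; ring
    rw [Finset.sum_congr rfl this, Finset.sum_const, Finset.card_range, nsmul_eq_mul]

lemma sum_range_linear_mul_linear (m : ℕ) (a b : ℝ) :
    ∑ k ∈ Finset.range m, (a - k) * (b + k)
      = m * (a * b) + (a - b) * (m * (m - 1) / 2) - m * (m - 1) * (2 * m - 1) / 6 := by
  rw [← sum_range_cast, ← sum_range_cast_sq, Finset.mul_sum]
  have : (m : ℝ) * (a * b) = ∑ _k ∈ Finset.range m, a * b := by simp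
  rw [this, ← Finset.sum_add_distrib, ← Finset.sum_sub_distrib]
  exact Finset.sum_congr rfl fun k _ => by ring

/-- The closed formula for the Kirchhoff index of `G_b`. -/
theorem statement17 (n l Δ : ℕ) (hl : 3 ≤ l) (hΔ : 3 ≤ Δ) (hn : l + Δ ≤ n) :
    kirchhoffIndex (Gb n l Δ)
      = ((l : ℝ) ^ 3 - (l : ℝ)) / 12
        + ((n : ℝ) - l - Δ + 2) * ((n : ℝ) - l - Δ + 3) * ((n : ℝ) - l + 2 * Δ - 2) / 6
        + ((n : ℝ) - l) * ((l : ℝ) ^ 2 - 1) / 6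
        + ((Δ : ℝ) - 1) * ((Δ : ℝ) - 2)
        + ((n : ℝ) - l - Δ + 2) * ((Δ : ℝ) - 1) * ((l : ℝ) - 1)
        + ((l : ℝ) - 1) * ((n : ℝ) - l - Δ + 1) * ((n : ℝ) - l - Δ + 2) / 2 := by
  obtain ⟨d, rfl⟩ : ∃ d, Δ = d + 1 := ⟨Δ - 1, by omega⟩
  obtain ⟨m, rfl⟩ : ∃ m, n = l + (m + 1) + d := ⟨n - l - d - 1, by omega⟩
  have hl0 : (l : ℝ) ≠ 0 := by positivity
  rw [kirchhoffIndex_Gb_eq_sum hl hΔ hn,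
    show l + (m + 1) + d - (d + 1) = l + m by omega, sum_subtreeSize l d m hl,
    sum_range_linear_mul_linear, sum_range_linear_mul_linear, sum_range_cast, sum_range_cast_sq]
  push_cast
  field_simp
  ring

end KfPaper
end
end

section
/- Let l ≥ 3, Δ ≥ 3 and n ≥ l + Δ − 2. Then (n−Δ+1)(n−Δ+2)(n+2Δ−9)/6 + (Δ−3)(Δ−2/3) + (n−Δ)² + 7(n−Δ)/3 + 2 − [ (l³−l)/12 + (n−l−Δ+5)(n−l−Δ+4)(n−l+2Δ−6)/6 + (n−l)(l²−1)/6 + (Δ−2)(l−1) + (Δ−3)(Δ−4) + (l−1)(n−l−Δ+2)(n−l−Δ+5)/2 ] ≥ l³/12 + (Δ/3 − 2/3)l² + (−3Δ/2 + 9/4)l + 3Δ/2 − 3 ≥ 0. (That is, the value Kf(P_{n,Δ}^3) dominates the closed-form expression for Kf(G_a) at every cycle length l.) -/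
/-- For `l ≥ 3`, `Δ ≥ 3` and `n ≥ l + Δ − 2`, the value `Kf(P_{n,Δ}^3)` dominates the
closed-form expression for `Kf(G_a)`: the difference is at least
`l³/12 + (Δ/3 − 2/3)l² + (−3Δ/2 + 9/4)l + 3Δ/2 − 3`, which is nonnegative. -/
theorem statement18 (n l Δ : ℕ) (hl : 3 ≤ l) (hΔ : 3 ≤ Δ) (hn : l + Δ - 2 ≤ n) :
    (((n : ℝ) - Δ + 1) * ((n : ℝ) - Δ + 2) * ((n : ℝ) + 2 * Δ - 9) / 6
        + ((Δ : ℝ) - 3) * ((Δ : ℝ) - 2 / 3) + ((n : ℝ) - Δ) ^ 2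
        + 7 * ((n : ℝ) - Δ) / 3 + 2)
      - (((l : ℝ) ^ 3 - (l : ℝ)) / 12
        + ((n : ℝ) - l - Δ + 5) * ((n : ℝ) - l - Δ + 4) * ((n : ℝ) - l + 2 * Δ - 6) / 6
        + ((n : ℝ) - l) * ((l : ℝ) ^ 2 - 1) / 6
        + ((Δ : ℝ) - 2) * ((l : ℝ) - 1)
        + ((Δ : ℝ) - 3) * ((Δ : ℝ) - 4)
        + ((l : ℝ) - 1) * ((n : ℝ) - l - Δ + 2) * ((n : ℝ) - l - Δ + 5) / 2)
      ≥ (l : ℝ) ^ 3 / 12 + ((Δ : ℝ) / 3 - 2 / 3) * (l : ℝ) ^ 2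
          + (-(3 * (Δ : ℝ) / 2) + 9 / 4) * (l : ℝ) + 3 * (Δ : ℝ) / 2 - 3
    ∧ (l : ℝ) ^ 3 / 12 + ((Δ : ℝ) / 3 - 2 / 3) * (l : ℝ) ^ 2
          + (-(3 * (Δ : ℝ) / 2) + 9 / 4) * (l : ℝ) + 3 * (Δ : ℝ) / 2 - 3 ≥ 0 := by
  have hl' : (3 : ℝ) ≤ l := by exact_mod_cast hl
  have hΔ' : (3 : ℝ) ≤ Δ := by exact_mod_cast hΔ
  have hn' : (l : ℝ) + Δ - 2 ≤ n := by
    have h : l + Δ ≤ n + 2 := by omega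
    have h' : (l : ℝ) + Δ ≤ n + 2 := by exact_mod_cast h
    linarith
  obtain ⟨a, ha⟩ : ∃ a : ℝ, (l : ℝ) = 3 + a := ⟨l - 3, by ring⟩
  obtain ⟨b, hb⟩ : ∃ b : ℝ, (Δ : ℝ) = 3 + b := ⟨Δ - 3, by ring⟩
  obtain ⟨c, hc⟩ : ∃ c : ℝ, (n : ℝ) = l + Δ - 2 + c := ⟨n - (l + Δ - 2), by ring⟩
  have ha0 : 0 ≤ a := by linarith
  have hb0 : 0 ≤ b := by linarith
  have hc0 : 0 ≤ c := by linarith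
  rw [hc, ha, hb]
  constructor
  · rw [ge_iff_le, ← sub_nonneg]
    ring_nf
    positivity
  · ring_nf
    positivity
end

section
/- For any tree T on n ≥ 2 vertices and any vertex v of T, W_v(T) ≤ n(n−1)/2, with equality if and only if T is a path with v as one of its end-vertices. -/
open scoped Classical

noncomputable section

namespace KfPaper

variable {V : Type*} {W : Type*}

/-- `H` is a path graph having `r` as one of its end-vertices. -/
def IsEndPath (H : SimpleGraph W) (r : W) : Prop :=
  ∃ (m : ℕ) (e : H ≃g SimpleGraph.pathGraph m), (e r).val = 0

/-- If the values of `f : α → ℕ` on a set of `k` elements form an initial segment of `ℕ`, their sum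
is at most `0 + 1 + ⋯ + (k - 1)`, and `f` is injective on the set in case of equality. -/
theorem sum_le_sum_range_and_injOn {α : Type*} (f : α → ℕ) (k : ℕ) (s : Finset α)
    (hs : s.card = k) (hf : ∀ x ∈ s, ∀ i, f x = i + 1 → ∃ y ∈ s, f y = i) :
    ∑ x ∈ s, f x ≤ ∑ i ∈ Finset.range k, i ∧
      (∑ x ∈ s, f x = ∑ i ∈ Finset.range k, i → Set.InjOn f s) := by
  induction k generalizing s with
  | zero =>
    obtain rfl := Finset.card_eq_zero.mp hs
    simp
  | succ k ih =>
    have hne : s.Nonempty := Finset.card_pos.mp (by omega)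
    obtain ⟨a, ha, hmax⟩ := s.exists_max_image f hne
    have himage : ∀ i j, i + j = f a → ∃ y ∈ s, f y = i := by
      intro i j
      induction j generalizing i with
      | zero => exact fun h => ⟨a, ha, by omega⟩
      | succ j ihj =>
        intro h
        obtain ⟨y, hy, hyi⟩ := ihj (i + 1) (by omega)
        exact hf y hy i hyi
    have hsub : Finset.range (f a + 1) ⊆ s.image f := by
      intro i hi
      rw [Finset.mem_range] at hi
      obtain ⟨y, hy, hyi⟩ := himage i (f a - i) (by omega)
      exact Finset.mem_image.mpr ⟨y, hy, hyi⟩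
    have hcard := Finset.card_le_card hsub
    rw [Finset.card_range] at hcard
    have hle := Finset.card_image_le (s := s) (f := f)
    have herase := ih (s.erase a) (by rw [Finset.card_erase_of_mem ha]; omega) (by
      intro x hx i hi
      have hxs := Finset.mem_of_mem_erase hx
      obtain ⟨y, hy, hyi⟩ := hf x hxs i hi
      have := hmax x hxs
      refine ⟨y, Finset.mem_erase.mpr ⟨?_, hy⟩, hyi⟩
      rintro rfl
      omega)
    rw [← Finset.add_sum_erase s f ha, Finset.sum_range_succ]
    refine ⟨by have := herase.1; omega, fun heq => ?_⟩
    have := herase.1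
    exact Finset.card_image_iff.mp (by omega)

theorem _root_.SimpleGraph.Connected.exists_adj_dist_eq {G : SimpleGraph V} (hG : G.Connected)
    {v w : V} {k : ℕ} (h : G.dist v w = k + 1) : ∃ u, G.Adj w u ∧ G.dist v u = k := by
  obtain ⟨p, hp⟩ := hG.exists_walk_length_eq_dist w v
  rw [SimpleGraph.dist_comm, h] at hp
  cases p with
  | nil => simp at hp
  | @cons _ u _ hadj q =>
    refine ⟨u, hadj, ?_⟩
    have h₁ := SimpleGraph.dist_le q
    have h₂ := hG.dist_triangle (u := v) (v := u) (w := w)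
    rw [SimpleGraph.dist_eq_one_iff_adj.mpr hadj.symm] at h₂
    rw [SimpleGraph.dist_comm] at h₁
    rw [SimpleGraph.Walk.length_cons] at hp
    omega

theorem isEndPath_of_injective_dist [Fintype V] {T : SimpleGraph V} (hT : T.IsTree) (v : V)
    (hinj : Function.Injective (T.dist v)) : IsEndPath T v := by
  have hlt : ∀ u, T.dist v u < Fintype.card V := fun u => by
    obtain ⟨p, hp, hlen⟩ := hT.connected.exists_path_of_dist v u
    exact hlen ▸ hp.length_lt
  have hbij : Function.Bijective fun u => (⟨T.dist v u, hlt u⟩ : Fin (Fintype.card V)) := by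
    rw [Fintype.bijective_iff_injective_and_card]
    exact ⟨fun a b hab => hinj (Fin.mk.inj hab), by simp⟩
  have hadj : ∀ {a b}, T.dist v a + 1 = T.dist v b → T.Adj b a := fun {a b} hab => by
    obtain ⟨u, hu, hdist⟩ := hT.connected.exists_adj_dist_eq hab.symm
    exact hinj hdist ▸ hu
  refine ⟨Fintype.card V, ⟨Equiv.ofBijective _ hbij, fun {a b} => ?_⟩, by simp⟩
  simp only [SimpleGraph.pathGraph_adj, Equiv.ofBijective_apply]
  refine ⟨fun h => h.elim (fun h => (hadj h).symm) hadj, fun h => ?_⟩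
  have := hT.dist_eq_dist_add_one_of_adj v h
  omega

theorem val_le_val_add_length {m : ℕ} {a b : Fin m} (p : (SimpleGraph.pathGraph m).Walk a b) :
    b.val ≤ a.val + p.length := by
  induction p with
  | nil => simp
  | cons h p ih =>
    rw [SimpleGraph.pathGraph_adj] at h
    rw [SimpleGraph.Walk.length_cons]
    omega

theorem sum_range_le_sum_dist_of_isEndPath [Fintype V] {T : SimpleGraph V} (hT : T.Connected)
    {v : V} (h : IsEndPath T v) :
    ∑ i ∈ Finset.range (Fintype.card V), i ≤ ∑ u, T.dist v u := by
  obtain ⟨m, e, he⟩ := h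
  have hm : Fintype.card V = m := by simpa using Fintype.card_congr e.toEquiv
  rw [hm, ← Fin.sum_univ_eq_sum_range (fun i => i) m, ← e.toEquiv.sum_comp]
  refine Finset.sum_le_sum fun u _ => ?_
  obtain ⟨p, hp⟩ := hT.exists_walk_length_eq_dist v u
  have := val_le_val_add_length (p.map e.toHom)
  rw [SimpleGraph.Walk.length_map, hp] at this
  simpa [he] using this

/-- For any tree `T` on `n ≥ 2` vertices and any vertex `v`, `W_v(T) ≤ n(n−1)/2`, with
equality exactly when `T` is a path having `v` as an end-vertex. -/
theorem statement19 [Fintype V] (T : SimpleGraph V) (n : ℕ) (hn : 2 ≤ n)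
    (hcard : Fintype.card V = n) (hT : T.IsTree) (v : V) :
    wienerAt T v ≤ (n : ℝ) * ((n : ℝ) - 1) / 2
    ∧ (wienerAt T v = (n : ℝ) * ((n : ℝ) - 1) / 2 ↔ IsEndPath T v) := by
  subst hcard
  have hsum := sum_le_sum_range_and_injOn (T.dist v) (Fintype.card V) Finset.univ
    Finset.card_univ (fun x _ i hi => by
      obtain ⟨u, -, hu⟩ := hT.connected.exists_adj_dist_eq hi
      exact ⟨u, Finset.mem_univ u, hu⟩)
  have hW : wienerAt T v = ((∑ u, T.dist v u : ℕ) : ℝ) := by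
    rw [wienerAt, Nat.cast_sum]
  have hR : (Fintype.card V : ℝ) * ((Fintype.card V : ℝ) - 1) / 2 =
      ((∑ i ∈ Finset.range (Fintype.card V), i : ℕ) : ℝ) := by
    have h := congrArg (Nat.cast (R := ℝ)) (Finset.sum_range_id_mul_two (Fintype.card V))
    rw [Nat.cast_mul, Nat.cast_mul, Nat.cast_sub (by omega)] at h
    norm_num at h ⊢
    linarith
  rw [hW, hR, Nat.cast_le, Nat.cast_inj]
  refine ⟨hsum.1, fun h => isEndPath_of_injective_dist hT v ?_, fun h => ?_⟩
  · exact Set.injOn_univ.mp (by simpa using hsum.2 h)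
  · exact hsum.1.antisymm (sum_range_le_sum_dist_of_isEndPath hT.connected h)

end KfPaper
end
end
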